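/- Let D_σ be the distribution obtained by sampling v uniformly from [0,1)^n and then sampling from the discrete Gaussian D_{ℤ^n+v, σ√(2π)}. For any ε ∈ (0, 1/2), if σ ≥ √(ln(2n(1+1/ε))/(2π²)), then the total variation distance between N(0, σ² I_n) and D_σ is at most 4ε. -/

import Mathlib

open MeasureTheory ProbabilityTheory
open scoped BigOperators Real

noncomputable section

/-- `ρ_s(x) = exp(−π‖x‖²/s²)`. -/
def rhoFn {n : ℕ} (s : ℝ) (x : Fin n → ℝ) : ℝ :=
  Real.exp (-π * (∑ i, x i ^ 2) / s ^ 2)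

/-- The discrete Gaussian distribution `D_{ℤ^n + v, s}` on the shifted lattice `ℤ^n + v`,
assigning to each point `z + v` (for `z ∈ ℤ^n`) probability `ρ_s(z+v)/ρ_s(ℤ^n+v)`. -/
def discreteGaussian (n : ℕ) (v : Fin n → ℝ) (s : ℝ) : Measure (Fin n → ℝ) :=
  Measure.sum fun z : Fin n → ℤ =>
    (ENNReal.ofReal (rhoFn s ((fun i => (z i : ℝ)) + v) /
        ∑' w : Fin n → ℤ, rhoFn s ((fun i => (w i : ℝ)) + v))) •
      Measure.dirac ((fun i => (z i : ℝ)) + v)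

/-- `D_σ`: sample `v` uniformly from `[0,1)^n`, then sample from `D_{ℤ^n+v, σ√(2π)}`. -/
def Dsigma (n : ℕ) (σ : ℝ) : Measure (Fin n → ℝ) :=
  (Measure.pi fun _ : Fin n => volume.restrict (Set.Ico (0 : ℝ) 1)).bind
    fun v => discreteGaussian n v (σ * Real.sqrt (2 * π))

/-- One-dimensional theta bound. -/
lemma theta_bound (f : ℤ → ℂ) (q : ℝ) (hq0 : 0 ≤ q) (hq1 : q < 1) (h0 : f 0 = 1)
    (h : ∀ k : ℤ, ‖f k‖ ≤ q ^ (k.natAbs)) : ‖∑' k, f k - 1‖ ≤ 2 * (q / (1 - q)) := by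
  have hg : HasSum (fun n : ℕ => q ^ (n + 1)) (q / (1 - q)) := by
    have := (hasSum_geometric_of_lt_one hq0 hq1).mul_left q
    simpa [pow_succ', div_eq_mul_inv] using this
  have b1 : ∀ n : ℕ, ‖f ((n + 1 : ℕ) : ℤ)‖ ≤ q ^ (n + 1) := fun n => by
    have := h ((n + 1 : ℕ) : ℤ)
    rwa [Int.natAbs_natCast] at this
  have b2 : ∀ n : ℕ, ‖f (-((n : ℤ) + 1))‖ ≤ q ^ (n + 1) := fun n => by
    have := h (-((n : ℤ) + 1))
    rwa [Int.natAbs_neg, show ((n : ℤ) + 1).natAbs = n + 1 by omega] at this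
  have s1 : Summable fun n : ℕ => f ((n + 1 : ℕ) : ℤ) :=
    Summable.of_norm_bounded hg.summable b1
  have s2 : Summable fun n : ℕ => f (-((n : ℤ) + 1)) :=
    Summable.of_norm_bounded hg.summable b2
  have s0 : Summable fun n : ℕ => f (n : ℤ) := (summable_nat_add_iff 1).1 s1
  have e := (HasSum.of_nat_of_neg_add_one s0.hasSum s2.hasSum).tsum_eq
  have e0 := s0.tsum_eq_zero_add
  rw [e, e0]
  have n1 := tsum_of_norm_bounded hg b1
  have n2 := tsum_of_norm_bounded hg b2
  have : (f ((0 : ℕ) : ℤ) + ∑' n : ℕ, f ((n + 1 : ℕ) : ℤ) + ∑' n : ℕ, f (-((n : ℤ) + 1)) - 1)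
      = ∑' n : ℕ, f ((n + 1 : ℕ) : ℤ) + ∑' n : ℕ, f (-((n : ℤ) + 1)) := by
    simp only [Nat.cast_zero, h0]; ring
  rw [this]
  refine (norm_add_le _ _).trans ?_
  linarith

lemma S1_bound (s t : ℝ) (hs : 0 < s) :
    |(∑' k : ℤ, Real.exp (-π * ((k : ℝ) + t) ^ 2 / s ^ 2)) / s - 1| ≤
      2 * (Real.exp (-π * s ^ 2) / (1 - Real.exp (-π * s ^ 2))) := by
  have hre : 0 < ((s ^ 2 : ℝ) : ℂ).re := by rw [Complex.ofReal_re]; positivity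
  have P := Complex.tsum_exp_neg_quadratic hre (-Complex.I * t)
  have hq1 : Real.exp (-π * s ^ 2) < 1 := by
    rw [Real.exp_lt_one_iff]; have := Real.pi_pos; nlinarith [sq_pos_of_pos hs, mul_pos this (sq_pos_of_pos hs)]
  have B := theta_bound (fun n : ℤ => Complex.exp (-π * ((s ^ 2 : ℝ) : ℂ) * n ^ 2
      + 2 * π * (-Complex.I * t) * n)) (Real.exp (-π * s ^ 2)) (Real.exp_pos _).le hq1
    (by simp) (by
      intro k
      rw [Complex.norm_exp, ← Real.exp_nat_mul]
      apply Real.exp_le_exp.2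
      have e : (-π * ((s ^ 2 : ℝ) : ℂ) * (k : ℂ) ^ 2 + 2 * π * (-Complex.I * t) * k)
        = ((-π * s ^ 2 * (k : ℝ) ^ 2 : ℝ) : ℂ) + ((-2 * π * t * k : ℝ) : ℂ) * Complex.I := by
        push_cast; ring
      rw [e]
      simp only [Complex.add_re, Complex.ofReal_re, Complex.re_ofReal_mul, Complex.I_re, mul_zero, add_zero]
      have h1 : ((k.natAbs : ℕ) : ℝ) ≤ (k : ℝ) ^ 2 := by
        have : ((k.natAbs : ℕ) : ℤ) ≤ k ^ 2 := by
          rw [← Int.natAbs_sq]; exact_mod_cast Nat.le_self_pow two_ne_zero _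
        have h3 : (((k.natAbs : ℕ) : ℤ) : ℝ) ≤ ((k ^ 2 : ℤ) : ℝ) := Int.cast_le.2 this
        rwa [Int.cast_natCast, Int.cast_pow] at h3
      have h2 : 0 < π * s ^ 2 := by positivity
      nlinarith)
  rw [P] at B
  have hc : ((s ^ 2 : ℝ) : ℂ) ^ (1 / 2 : ℂ) = (s : ℂ) := by
    rw [show (1 / 2 : ℂ) = ((1 / 2 : ℝ) : ℂ) by push_cast; rfl, ← Complex.ofReal_cpow (by positivity),
      ← Real.sqrt_eq_rpow, Real.sqrt_sq hs.le]
  have ht : (∑' n : ℤ, Complex.exp (-π / ((s ^ 2 : ℝ) : ℂ) * (n + Complex.I * (-Complex.I * t)) ^ 2))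
      = ((∑' k : ℤ, Real.exp (-π * ((k : ℝ) + t) ^ 2 / s ^ 2) : ℝ) : ℂ) := by
    rw [Complex.ofReal_tsum]
    congr 1; ext k
    rw [show Complex.I * (-Complex.I * t) = t by
      rw [← mul_assoc, mul_neg, Complex.I_mul_I]; simp]
    push_cast
    congr 1; ring
  rw [hc, ht] at B
  rw [← Real.norm_eq_abs, ← Complex.norm_real]
  refine le_of_eq_of_le ?_ B
  congr 1; push_cast; ring

lemma tsum_pi_prod : ∀ (n : ℕ) (f : Fin n → ℤ → ENNReal),
    ∑' z : Fin n → ℤ, ∏ i, f i (z i) = ∏ i, ∑' k, f i k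
  | 0, f => by simp
  | n + 1, f => by
    rw [← (Fin.consEquiv (fun _ : Fin (n+1) => ℤ)).tsum_eq, ENNReal.tsum_prod', Fin.prod_univ_succ,
      ← tsum_pi_prod n, ← ENNReal.tsum_mul_right]
    congr 1; ext k
    rw [← ENNReal.tsum_mul_left]
    congr 1; ext z
    simp [Fin.consEquiv, Fin.prod_univ_succ]

lemma tiling (n : ℕ) (f : (Fin n → ℝ) → ENNReal) (hf : Measurable f) :
    ∫⁻ x, f x = ∫⁻ v, (∑' z : Fin n → ℤ, f ((fun i => (z i : ℝ)) + v))
      ∂(Measure.pi fun _ : Fin n => volume.restrict (Set.Ico (0 : ℝ) 1)) := by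
  have hm : (Measure.pi fun _ : Fin n => volume.restrict (Set.Ico (0 : ℝ) 1)) =
      (volume : Measure (Fin n → ℝ)).restrict (Set.univ.pi fun _ => Set.Ico (0 : ℝ) 1) := by
    rw [volume_pi, Measure.restrict_pi_pi]
  rw [hm, lintegral_tsum (fun z => by fun_prop)]
  let B : (Fin n → ℤ) → Set (Fin n → ℝ) := fun z => (fun x => fun i => ⌊x i⌋) ⁻¹' {z}
  have hfl : Measurable (fun x : Fin n → ℝ => fun i => ⌊x i⌋) := by fun_prop
  have hB : ∀ z, MeasurableSet (B z) := fun z => hfl (measurableSet_singleton z)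
  have hU : (⋃ z, B z) = Set.univ := by
    ext x; simp [B]
  have hd : Pairwise (Function.onFun Disjoint B) := by
    intro z w h
    refine Set.disjoint_left.2 fun x hx hy => h ?_
    simp only [B, Set.mem_preimage, Set.mem_singleton_iff] at hx hy
    exact hx.symm.trans hy
  rw [← setLIntegral_univ, ← hU, lintegral_iUnion hB hd]
  congr 1; ext z
  have mp := measurePreserving_add_left (volume : Measure (Fin n → ℝ)) (fun i => (z i : ℝ))
  rw [← mp.setLIntegral_comp_preimage_emb (MeasurableEquiv.addLeft _).measurableEmbedding f (B z)]
  congr 2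
  ext v
  simp only [B, Set.mem_preimage, Set.mem_singleton_iff, funext_iff, Pi.add_apply, Int.floor_intCast_add,
    Set.mem_pi, Set.mem_univ, forall_const, add_eq_left, Int.floor_eq_zero_iff]

lemma lintegral_pi_prod (n : ℕ) (p : ℝ → ℝ) (hp : ∀ x, 0 ≤ p x) (hi : Integrable p) (A : Fin n → Set ℝ) :
    ∫⁻ x in Set.univ.pi A, ∏ i : Fin n, ENNReal.ofReal (p (x i)) = ∏ i, ∫⁻ x in A i, ENNReal.ofReal (p x) := by
  have e : ∀ x : Fin n → ℝ, ∏ i : Fin n, ENNReal.ofReal (p (x i)) = ENNReal.ofReal (∏ i, p (x i)) :=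
    fun x => (ENNReal.ofReal_prod_of_nonneg fun i _ => hp _).symm
  simp_rw [e]
  rw [volume_pi, Measure.restrict_pi_pi]
  have hI : ∀ i, Integrable p (volume.restrict (A i)) := fun i => hi.restrict
  rw [← ofReal_integral_eq_lintegral_ofReal (Integrable.fintype_prod (f := fun _ => p) hI)
    (Filter.Eventually.of_forall fun x => Finset.prod_nonneg fun i _ => hp _),
    integral_fintype_prod_eq_prod (fun _ => p), ENNReal.ofReal_prod_of_nonneg
      (fun i _ => integral_nonneg hp)]
  congr 1; ext i
  rw [← ofReal_integral_eq_lintegral_ofReal (hI i) (Filter.Eventually.of_forall hp)]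

lemma pi_gauss (n : ℕ) (v : NNReal) (hv : v ≠ 0) :
    (Measure.pi fun _ : Fin n => gaussianReal 0 v) =
      (volume : Measure (Fin n → ℝ)).withDensity
        (fun x => ∏ i, ENNReal.ofReal (gaussianPDFReal 0 v (x i))) := by
  refine Measure.pi_eq fun A hA => ?_
  rw [withDensity_apply _ (MeasurableSet.univ_pi hA), lintegral_pi_prod n _ (gaussianPDFReal_nonneg 0 v)
    (integrable_gaussianPDFReal 0 v) A]
  congr 1; ext i
  rw [gaussianReal_apply 0 hv]; rfl

/-- The one-dimensional Gaussian sum over `ℤ + t`. -/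
def S1 (s t : ℝ) : ℝ := ∑' k : ℤ, Real.exp (-π * ((k : ℝ) + t) ^ 2 / s ^ 2)

lemma S1_periodic (s t : ℝ) (m : ℤ) : S1 s ((m : ℝ) + t) = S1 s t := by
  unfold S1
  rw [← (Equiv.addRight m).tsum_eq (fun k : ℤ => Real.exp (-π * ((k : ℝ) + t) ^ 2 / s ^ 2))]
  congr 1; ext k
  simp only [Equiv.coe_addRight]
  push_cast
  rw [add_assoc]

lemma S1_summable (s t : ℝ) (h : 0 < S1 s t) :
    Summable fun k : ℤ => Real.exp (-π * ((k : ℝ) + t) ^ 2 / s ^ 2) := by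
  by_contra hc
  rw [S1, tsum_eq_zero_of_not_summable hc] at h
  exact lt_irrefl _ h

lemma S1_meas (s : ℝ) : Measurable (S1 s) := by
  have : S1 s = fun t => (∑' k : ℤ, ENNReal.ofReal (Real.exp (-π * ((k : ℝ) + t) ^ 2 / s ^ 2))).toReal := by
    ext t
    rw [ENNReal.tsum_toReal_eq (fun _ => ENNReal.ofReal_ne_top)]
    simp only [ENNReal.toReal_ofReal (Real.exp_pos _).le]; rfl
  rw [this]
  apply Measurable.ennreal_toReal
  refine Measurable.tsum fun k => ?_
  fun_prop

lemma rhoFn_prod {n : ℕ} (s : ℝ) (x : Fin n → ℝ) :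
    rhoFn s x = ∏ i, Real.exp (-π * (x i) ^ 2 / s ^ 2) := by
  rw [rhoFn, ← Real.exp_sum, Finset.mul_sum, Finset.sum_div]

lemma Sn_eq {n : ℕ} (s : ℝ) (h : ∀ t, 0 < S1 s t) (v : Fin n → ℝ) :
    ∑' w : Fin n → ℤ, rhoFn s ((fun i => (w i : ℝ)) + v) = ∏ i, S1 s (v i) := by
  have e : ∑' w : Fin n → ℤ, ENNReal.ofReal (rhoFn s ((fun i => (w i : ℝ)) + v)) =
      ENNReal.ofReal (∏ i, S1 s (v i)) := by
    simp_rw [rhoFn_prod, ENNReal.ofReal_prod_of_nonneg (fun i _ => (Real.exp_pos _).le), Pi.add_apply]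
    rw [tsum_pi_prod n (fun i k => ENNReal.ofReal (Real.exp (-π * ((k : ℝ) + v i) ^ 2 / s ^ 2))),
      ENNReal.ofReal_prod_of_nonneg (fun i _ => (h _).le)]
    congr 1; ext i
    rw [S1, ENNReal.ofReal_tsum_of_nonneg (fun _ => (Real.exp_pos _).le) (S1_summable s _ (h _))]
  have e2 := congrArg ENNReal.toReal e
  rw [ENNReal.tsum_toReal_eq (fun _ => ENNReal.ofReal_ne_top),
    ENNReal.toReal_ofReal (Finset.prod_nonneg fun i _ => (h _).le)] at e2
  rw [← e2]
  congr 1; ext w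
  rw [ENNReal.toReal_ofReal]
  exact (Real.exp_pos _).le

/-- The density of `Dsigma`. -/
def dens {n : ℕ} (s : ℝ) (x : Fin n → ℝ) : ℝ := rhoFn s x / ∏ i, S1 s (x i)

lemma dens_meas {n : ℕ} (s : ℝ) : Measurable (dens (n := n) s) := by
  have := S1_meas s
  unfold dens rhoFn
  fun_prop

lemma dg_apply {n : ℕ} (s : ℝ) (h : ∀ t, 0 < S1 s t) (v : Fin n → ℝ) (A : Set (Fin n → ℝ))
    (hA : MeasurableSet A) :
    discreteGaussian n v s A =
      ∑' z : Fin n → ℤ, A.indicator (fun x => ENNReal.ofReal (dens s x)) ((fun i => (z i : ℝ)) + v) := by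
  rw [discreteGaussian, Measure.sum_apply _ hA]
  congr 1; ext z
  rw [Measure.smul_apply, Measure.dirac_apply' _ hA, Sn_eq s h]
  have : dens s ((fun i => (z i : ℝ)) + v) = rhoFn s ((fun i => (z i : ℝ)) + v) / ∏ i, S1 s (v i) := by
    simp only [dens, Pi.add_apply, S1_periodic]
  rw [← this]
  by_cases hx : ((fun i => (z i : ℝ)) + v) ∈ A <;> simp [hx]

lemma Dsigma_apply {n : ℕ} (σ : ℝ) (h : ∀ t, 0 < S1 (σ * Real.sqrt (2 * π)) t) (A : Set (Fin n → ℝ))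
    (hA : MeasurableSet A) :
    Dsigma n σ A = ∫⁻ x in A, ENNReal.ofReal (dens (σ * Real.sqrt (2 * π)) x) := by
  have hd := dens_meas (n := n) (σ * Real.sqrt (2 * π))
  have hind : ∀ A : Set (Fin n → ℝ), MeasurableSet A →
      Measurable (A.indicator (fun x => ENNReal.ofReal (dens (σ * Real.sqrt (2 * π)) x))) :=
    fun A hA => hd.ennreal_ofReal.indicator hA
  rw [Dsigma, Measure.bind_apply hA, ← lintegral_indicator hA, tiling n _ (hind A hA)]
  · simp_rw [dg_apply _ h _ A hA]
  · refine (Measure.measurable_of_measurable_coe _ fun B hB => ?_).aemeasurable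
    simp_rw [dg_apply _ h _ B hB]
    exact Measurable.tsum fun z => (hind B hB).comp (measurable_const_add _)

lemma numerics (n : ℕ) (hn : 1 ≤ n) (ε : ℝ) (hε0 : 0 < ε) (hε : ε < 1 / 2) (σ : ℝ)
    (hσ : Real.sqrt (Real.log (2 * n * (1 + 1 / ε)) / (2 * π ^ 2)) ≤ σ) :
    0 < σ ∧ ∃ a : ℝ, 0 < a ∧
      a = 2 * (Real.exp (-(2 * π ^ 2 * σ ^ 2)) / (1 - Real.exp (-(2 * π ^ 2 * σ ^ 2)))) ∧
      n * a * (1 + ε) ≤ 6 / 5 * ε := by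
  have hn' : (1 : ℝ) ≤ n := by exact_mod_cast hn
  have hpi := Real.pi_pos
  have hM : (6 : ℝ) ≤ 2 * n * (1 + 1 / ε) := by
    have : 2 ≤ 1 / ε := by rw [le_div_iff₀ hε0]; linarith
    nlinarith
  have hL : 0 < Real.log (2 * n * (1 + 1 / ε)) := Real.log_pos (by linarith)
  have hσ0 : 0 < σ := lt_of_lt_of_le (Real.sqrt_pos.2 (by positivity)) hσ
  have hsq := (Real.sqrt_le_left hσ0.le).1 hσ
  rw [div_le_iff₀ (by positivity)] at hsq
  have hexp : 2 * n * (1 + 1 / ε) ≤ Real.exp (2 * π ^ 2 * σ ^ 2) := by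
    rw [← Real.log_le_iff_le_exp (by linarith)]; linarith
  refine ⟨hσ0, _, ?_, rfl, ?_⟩
  all_goals
    rw [Real.exp_neg]
    set E := Real.exp (2 * π ^ 2 * σ ^ 2)
    have hE : 6 ≤ E := hM.trans hexp
    have e : E⁻¹ / (1 - E⁻¹) = 1 / (E - 1) := by
      have : E - 1 ≠ 0 := by linarith
      have : E ≠ 0 := by linarith
      have : 1 - E⁻¹ ≠ 0 := by
        intro h
        have : E⁻¹ ≤ 1 / 6 := by rw [inv_le_comm₀ (by linarith) (by norm_num)]; linarith
        linarith
      field_simp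
    rw [e]
  · have : 0 < E - 1 := by linarith
    positivity
  · have h1 : 0 < E - 1 := by linarith
    rw [show (n : ℝ) * (2 * (1 / (E - 1))) * (1 + ε) = (2 * n * (1 + ε)) / (E - 1) by ring,
      div_le_iff₀ h1]
    have h2 : 2 * n * (1 + ε) ≤ E * ε := by
      have := mul_le_mul_of_nonneg_right hexp hε0.le
      refine le_trans (le_of_eq ?_) this
      field_simp
      try ring
    nlinarith

lemma main_pos (n : ℕ) (hn : 1 ≤ n) (ε : ℝ) (hε0 : 0 < ε) (hε : ε < 1 / 2) (σ : ℝ)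
    (hσ : Real.sqrt (Real.log (2 * n * (1 + 1 / ε)) / (2 * π ^ 2)) ≤ σ)
    (A : Set (Fin n → ℝ)) (hA : MeasurableSet A) :
      |(((Measure.pi fun _ : Fin n => gaussianReal 0 (Real.toNNReal (σ ^ 2))) A).toReal -
          ((Dsigma n σ) A).toReal)| ≤ 4 * ε := by
  obtain ⟨hσ0, a, ha0, ha, hna⟩ := numerics n hn ε hε0 hε σ hσ
  have hn' : (1 : ℝ) ≤ n := by exact_mod_cast hn
  have hpi := Real.pi_pos
  set s := σ * Real.sqrt (2 * π) with hs
  have hs0 : 0 < s := by positivity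
  have hs2 : s ^ 2 = 2 * π * σ ^ 2 := by
    rw [hs, mul_pow, Real.sq_sqrt (by positivity)]; ring
  have hB : ∀ t, |S1 s t / s - 1| ≤ a := by
    intro t
    have := S1_bound s t hs0
    rw [hs2, show -π * (2 * π * σ ^ 2) = -(2 * π ^ 2 * σ ^ 2) by ring, ← ha, ← hs2] at this
    exact this
  set x : ℝ := n * a with hx
  have hx0 : 0 < x := by positivity
  have hxε : x ≤ 6 / 5 * ε := by nlinarith
  have hx1 : x ≤ 2 / 5 := by
    have : x * (1 + ε) ≤ 2 / 5 * (1 + ε) := by linarith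
    exact le_of_mul_le_mul_right this (by linarith)
  have hax : a ≤ x := by nlinarith
  have hSpos : ∀ t, 0 < S1 s t := by
    intro t
    have h1 := (abs_le.1 (hB t)).1
    have : 0 < S1 s t / s := by linarith
    rcases div_pos_iff.1 this with h | h
    · exact h.1
    · linarith [h.2]
  -- the Gaussian density
  let g : (Fin n → ℝ) → ℝ := fun y => ∏ i, gaussianPDFReal 0 (Real.toNNReal (σ ^ 2)) (y i)
  have hv : Real.toNNReal (σ ^ 2) ≠ 0 := by
    rw [Ne, Real.toNNReal_eq_zero, not_le]; positivity
  have hg0 : ∀ y, 0 ≤ g y := fun y => Finset.prod_nonneg fun i _ => gaussianPDFReal_nonneg _ _ _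
  have hgr : ∀ y, g y = rhoFn s y / s ^ n := by
    intro y
    simp only [g]
    rw [rhoFn_prod]
    have : s ^ n = ∏ _i : Fin n, s := by simp
    rw [this, ← Finset.prod_div_distrib]
    refine Finset.prod_congr rfl fun i _ => ?_
    rw [gaussianPDFReal, Real.coe_toNNReal _ (sq_nonneg σ)]
    have h1 : Real.sqrt (2 * π * σ ^ 2) = s := by rw [← hs2, Real.sqrt_sq hs0.le]
    have h2 : -(y i - 0) ^ 2 / (2 * σ ^ 2) = -π * y i ^ 2 / s ^ 2 := by
      rw [hs2, sub_zero]
      field_simp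
    rw [h1, h2, div_eq_mul_inv (Real.exp _) s, mul_comm]
  have hdg : ∀ y : Fin n → ℝ, dens s y * (∏ i, (S1 s (y i) / s)) = g y := by
    intro y
    have hp : (∏ i, S1 s (y i)) ≠ 0 := (Finset.prod_pos fun i _ => hSpos _).ne'
    rw [hgr, dens, Finset.prod_div_distrib]
    simp only [Finset.prod_const, Finset.card_univ, Fintype.card_fin]
    field_simp
  have hP1 : ∀ y : Fin n → ℝ, 1 - x ≤ ∏ i, (S1 s (y i) / s) := by
    intro y
    calc 1 - x = 1 + n * (-a) := by rw [hx]; ring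
      _ ≤ (1 + -a) ^ n := one_add_mul_le_pow (by linarith) n
      _ = ∏ _i : Fin n, (1 + -a) := by simp
      _ ≤ _ := Finset.prod_le_prod (fun i _ => by linarith)
        (fun i _ => by linarith [(abs_le.1 (hB (y i))).1])
  have hP2 : ∀ y : Fin n → ℝ, (∏ i, (S1 s (y i) / s)) * (1 - x) ≤ 1 := by
    intro y
    have h1 : ∏ i, (S1 s (y i) / s) ≤ (1 + a) ^ n := by
      calc _ ≤ ∏ _i : Fin n, (1 + a) := Finset.prod_le_prod (fun i _ => (div_pos (hSpos _) hs0).le)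
            (fun i _ => by linarith [(abs_le.1 (hB (y i))).2])
        _ = _ := by simp
    have h2 : 1 - x ≤ (1 - a) ^ n := by
      have := one_add_mul_le_pow (a := -a) (by linarith) n
      rw [hx]; simpa [sub_eq_add_neg] using this
    calc _ ≤ (1 + a) ^ n * (1 - a) ^ n := by
          apply mul_le_mul h1 h2 (by linarith) (by positivity)
      _ = (1 - a ^ 2) ^ n := by rw [← mul_pow]; ring
      _ ≤ 1 := pow_le_one₀ (by nlinarith) (by nlinarith)
  have hd0 : ∀ y : Fin n → ℝ, 0 ≤ dens s y := fun y =>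
    div_nonneg (Real.exp_pos _).le (Finset.prod_nonneg fun i _ => (hSpos _).le)
  have hlow : ∀ y, (1 - x) * g y ≤ dens s y := by
    intro y
    rw [← hdg y]
    nlinarith [hP2 y, hd0 y]
  have hup : ∀ y, (1 - x) * dens s y ≤ g y := by
    intro y
    rw [← hdg y]
    nlinarith [hP1 y, hd0 y]
  have hD := Dsigma_apply σ hSpos A hA
  have hG : (Measure.pi fun _ : Fin n => gaussianReal 0 (Real.toNNReal (σ ^ 2))) A =
      ∫⁻ y in A, ENNReal.ofReal (g y) := by
    rw [pi_gauss n _ hv, withDensity_apply _ hA]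
    congr 1; ext y
    rw [ENNReal.ofReal_prod_of_nonneg fun i _ => gaussianPDFReal_nonneg _ _ _]
  set G := (Measure.pi fun _ : Fin n => gaussianReal 0 (Real.toNNReal (σ ^ 2))) A with hGdef
  set D := Dsigma n σ A with hDdef
  have hGle : G ≤ 1 := prob_le_one
  have hgm : Measurable g := by
    have := measurable_gaussianPDFReal 0 (Real.toNNReal (σ ^ 2))
    simp only [g]; fun_prop
  have hdm := dens_meas (n := n) s
  have hx1' : 0 ≤ 1 - x := by linarith
  have I1 : ENNReal.ofReal (1 - x) * G ≤ D := by
    rw [hG, hD, ← lintegral_const_mul _ hgm.ennreal_ofReal]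
    refine lintegral_mono fun y => ?_
    rw [← ENNReal.ofReal_mul hx1']
    exact ENNReal.ofReal_le_ofReal (hlow y)
  have I2 : ENNReal.ofReal (1 - x) * D ≤ G := by
    rw [hG, hD, ← lintegral_const_mul _ hdm.ennreal_ofReal]
    refine lintegral_mono fun y => ?_
    rw [← ENNReal.ofReal_mul hx1']
    exact ENNReal.ofReal_le_ofReal (hup y)
  have hGtop : G ≠ ⊤ := ne_top_of_le_ne_top ENNReal.one_ne_top hGle
  have hDtop : D ≠ ⊤ := by
    intro h
    rw [h, ENNReal.mul_top (by simp; linarith)] at I2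
    exact hGtop (top_le_iff.1 I2)
  have J1 := ENNReal.toReal_mono hDtop I1
  have J2 := ENNReal.toReal_mono hGtop I2
  have J3 : G.toReal ≤ 1 := by simpa using ENNReal.toReal_mono ENNReal.one_ne_top hGle
  rw [ENNReal.toReal_mul, ENNReal.toReal_ofReal hx1'] at J1 J2
  have g0 : 0 ≤ G.toReal := ENNReal.toReal_nonneg
  have d0 : 0 ≤ D.toReal := ENNReal.toReal_nonneg
  rw [abs_le]
  constructor
  · have : D.toReal ≤ 5 / 3 := by nlinarith
    nlinarith
  · nlinarith

/-- For `ε ∈ (0, 1/2)`, if `σ ≥ √(ln(2n(1+1/ε))/(2π²))`, then the total variation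
distance between `N(0, σ² I_n)` and `D_σ` is at most `4ε`. -/
theorem stmt12 (n : ℕ) (ε : ℝ) (hε0 : 0 < ε) (hε : ε < 1 / 2) (σ : ℝ)
    (hσ : Real.sqrt (Real.log (2 * n * (1 + 1 / ε)) / (2 * π ^ 2)) ≤ σ) :
    ∀ A : Set (Fin n → ℝ), MeasurableSet A →
      |(((Measure.pi fun _ : Fin n => gaussianReal 0 (Real.toNNReal (σ ^ 2))) A).toReal -
          ((Dsigma n σ) A).toReal)| ≤ 4 * ε := by
  intro A hA
  rcases Nat.eq_zero_or_pos n with rfl | hn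
  · have hr : ∀ (s : ℝ) (y : Fin 0 → ℝ), rhoFn s y = 1 := by
      intro s y; simp [rhoFn]
    have hdg : ∀ v : Fin 0 → ℝ, discreteGaussian 0 v (σ * Real.sqrt (2 * π)) = Measure.dirac v := by
      intro v
      ext B hB
      rw [discreteGaussian, Measure.sum_apply _ hB]
      simp [hr, Subsingleton.elim _ v]
    have hD : Dsigma 0 σ = Measure.dirac isEmptyElim := by
      rw [Dsigma]
      simp_rw [hdg]
      rw [Measure.bind_dirac, Measure.pi_of_empty]
    rw [hD, Measure.pi_of_empty]
    simp only [sub_self, abs_zero]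
    linarith
  · exact main_pos n hn ε hε0 hε σ hσ A hA

end
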